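/- arXiv:1908.04096 — 2 statements merged into one kernel-verified Lean document; each statement's English description precedes it below -/
import Mathlib

section
/- Let D = D₁ ▽̄ D₂ be the bidirected Hajós join of two disjoint non-empty digraphs D₁ and D₂, and let k ≥ 3. If both D₁ and D₂ are k-critical, then D is k-critical. -/
/-- A finite digraph on the vertex type `ℕ`: a finite vertex set together with a
finite set of arcs (ordered pairs of vertices), loopless, without parallel arcs
(but opposite arcs between two vertices are allowed). -/
structure Digr where
  verts : Finset ℕ
  arcs : Finset (ℕ × ℕ)
  arcs_sub : ∀ a ∈ arcs, a.1 ∈ verts ∧ a.2 ∈ verts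
  no_loops : ∀ a ∈ arcs, a.1 ≠ a.2

namespace Digr

/-- `D'` is a subdigraph of `D`. -/
def Sub (D' D : Digr) : Prop := D'.verts ⊆ D.verts ∧ D'.arcs ⊆ D.arcs

/-- An acyclic coloring of `D` with `n` colors: no directed cycle is monochromatic.
A monochromatic directed cycle through `v` is exactly a nontrivial closed walk from `v`
to `v` along arcs whose endpoints always get equal colors. -/
def GoodColoring (D : Digr) (n : ℕ) (φ : ℕ → Fin n) : Prop :=
  ∀ v, ¬ Relation.TransGen (fun x y => (x, y) ∈ D.arcs ∧ φ x = φ y) v v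

/-- `D` admits an acyclic coloring with `n` colors. -/
def Colorable (D : Digr) (n : ℕ) : Prop := ∃ φ : ℕ → Fin n, D.GoodColoring n φ

/-- The dichromatic number of `D`. -/
noncomputable def dichrom (D : Digr) : ℕ := sInf {n | D.Colorable n}

/-- `D` is `k`-critical: its dichromatic number is `k` and every proper subdigraph
has smaller dichromatic number. -/
def Critical (k : ℕ) (D : Digr) : Prop :=
  D.dichrom = k ∧ ∀ D' : Digr, D'.Sub D → D' ≠ D → D'.dichrom < k

/-- Deletion of a vertex. -/
def delete (D : Digr) (v : ℕ) : Digr where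
  verts := D.verts.erase v
  arcs := D.arcs.filter (fun a => a.1 ≠ v ∧ a.2 ≠ v)
  arcs_sub := by
    intro a ha
    rw [Finset.mem_filter] at ha
    obtain ⟨ha, h1, h2⟩ := ha
    have h := D.arcs_sub a ha
    exact ⟨Finset.mem_erase.mpr ⟨h1, h.1⟩, Finset.mem_erase.mpr ⟨h2, h.2⟩⟩
  no_loops := fun a ha => D.no_loops a (Finset.mem_filter.mp ha).1

/-- The subdigraph of `D` induced by a set `S` of vertices. -/
def induce (D : Digr) (S : Finset ℕ) : Digr where
  verts := D.verts ∩ S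
  arcs := D.arcs.filter (fun a => a.1 ∈ S ∧ a.2 ∈ S)
  arcs_sub := by
    intro a ha
    rw [Finset.mem_filter] at ha
    obtain ⟨ha, h1, h2⟩ := ha
    have h := D.arcs_sub a ha
    exact ⟨Finset.mem_inter.mpr ⟨h.1, h1⟩, Finset.mem_inter.mpr ⟨h.2, h2⟩⟩
  no_loops := fun a ha => D.no_loops a (Finset.mem_filter.mp ha).1

/-- Out-neighborhood of `v` in `D`. -/
def outNbrs (D : Digr) (v : ℕ) : Finset ℕ := D.verts.filter (fun y => (v, y) ∈ D.arcs)

/-- In-neighborhood of `v` in `D`. -/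
def inNbrs (D : Digr) (v : ℕ) : Finset ℕ := D.verts.filter (fun x => (x, v) ∈ D.arcs)

/-- Out-degree. -/
def outDeg (D : Digr) (v : ℕ) : ℕ := (D.outNbrs v).card

/-- In-degree. -/
def inDeg (D : Digr) (v : ℕ) : ℕ := (D.inNbrs v).card

/-- `D` is (weakly) connected, i.e. its underlying graph is connected. -/
def Conn (D : Digr) : Prop :=
  ∀ x ∈ D.verts, ∀ y ∈ D.verts,
    Relation.ReflTransGen (fun a b => (a, b) ∈ D.arcs ∨ (b, a) ∈ D.arcs) x y

/-- `D` is strongly connected. -/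
def StronglyConn (D : Digr) : Prop :=
  ∀ x ∈ D.verts, ∀ y ∈ D.verts,
    Relation.ReflTransGen (fun a b => (a, b) ∈ D.arcs) x y

/-- `H` has no separating vertex. -/
def NoSepVertex (H : Digr) : Prop := ∀ v ∈ H.verts, (H.delete v).Conn

/-- `B` is a block of `D`: a maximal connected subdigraph of `D` without a
separating vertex. -/
def IsBlock (B D : Digr) : Prop :=
  B.Sub D ∧ B.Conn ∧ B.NoSepVertex ∧
    ∀ B' : Digr, B'.Sub D → B'.Conn → B'.NoSepVertex → B.Sub B' → B' = B

/-- `B` is a directed cycle (of length ≥ 2). -/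
def IsDirCycle (B : Digr) : Prop :=
  ∃ (n : ℕ) (f : ℕ → ℕ), 2 ≤ n ∧ Set.InjOn f ↑(Finset.range n) ∧
    B.verts = (Finset.range n).image f ∧
    B.arcs = (Finset.range n).image (fun i => (f i, f ((i + 1) % n)))

/-- `B` is a bidirected cycle of length `n`. -/
def IsBidirCycle (B : Digr) (n : ℕ) : Prop :=
  ∃ f : ℕ → ℕ, Set.InjOn f ↑(Finset.range n) ∧
    B.verts = (Finset.range n).image f ∧
    B.arcs = (Finset.range n).image (fun i => (f i, f ((i + 1) % n))) ∪
      (Finset.range n).image (fun i => (f ((i + 1) % n), f i))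

/-- `B` is a bidirected complete graph: every ordered pair of distinct vertices is an arc. -/
def IsBidirComplete (B : Digr) : Prop :=
  B.arcs = (B.verts ×ˢ B.verts).filter (fun a => a.1 ≠ a.2)

/-- `D` contains a bidirected complete graph on `k` vertices as a subdigraph. -/
def ContainsK (k : ℕ) (D : Digr) : Prop :=
  ∃ S : Finset ℕ, S ⊆ D.verts ∧ S.card = k ∧
    ∀ x ∈ S, ∀ y ∈ S, x ≠ y → (x, y) ∈ D.arcs

/-- `D` is the Dirac join of the disjoint digraphs `D1` and `D2`: their union
together with all arcs in both directions between them. -/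
def IsDiracJoin (D D1 D2 : Digr) : Prop :=
  Disjoint D1.verts D2.verts ∧
  D.verts = D1.verts ∪ D2.verts ∧
  D.arcs = D1.arcs ∪ D2.arcs ∪ D1.verts ×ˢ D2.verts ∪ D2.verts ×ˢ D1.verts

/-- `D` is the directed Hajós join `(D1, v1, u1) ▽ (D2, v2, u2)` of the disjoint
digraphs `D1` and `D2`: delete the arcs `u1v1` and `v2u2`, identify `v1` and `v2`
(the merged vertex is represented by `v1`), and add the arc `u1u2`. -/
def IsHajosJoin (D D1 D2 : Digr) (u1 v1 v2 u2 : ℕ) : Prop :=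
  Disjoint D1.verts D2.verts ∧
  (u1, v1) ∈ D1.arcs ∧ (v2, u2) ∈ D2.arcs ∧
  D.verts = D1.verts ∪ D2.verts.erase v2 ∧
  D.arcs = D1.arcs.erase (u1, v1) ∪
      (D2.arcs.erase (v2, u2)).image
        (Prod.map (fun x => if x = v2 then v1 else x) (fun x => if x = v2 then v1 else x)) ∪
      {(u1, u2)}

/-- `D` is the bidirected Hajós join `(D1, v1, u1) ▽̄ (D2, v2, u2)` of the disjoint
digraphs `D1` and `D2`: delete both arcs of the digon between `u1` and `v1` and both
arcs of the digon between `u2` and `v2`, identify `v1` and `v2` (the merged vertex is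
represented by `v1`), and add both arcs `u1u2` and `u2u1`. -/
def IsBidirHajosJoin (D D1 D2 : Digr) (u1 v1 v2 u2 : ℕ) : Prop :=
  Disjoint D1.verts D2.verts ∧
  (u1, v1) ∈ D1.arcs ∧ (v1, u1) ∈ D1.arcs ∧
  (u2, v2) ∈ D2.arcs ∧ (v2, u2) ∈ D2.arcs ∧
  D.verts = D1.verts ∪ D2.verts.erase v2 ∧
  D.arcs = ((D1.arcs.erase (u1, v1)).erase (v1, u1)) ∪
      (((D2.arcs.erase (v2, u2)).erase (u2, v2)).image
        (Prod.map (fun x => if x = v2 then v1 else x) (fun x => if x = v2 then v1 else x))) ∪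
      {(u1, u2), (u2, u1)}

/-- `D'` is obtained from `D` by identifying the non-empty independent set `I`
with the (new) vertex `v`. -/
def IsIdent (D' D : Digr) (I : Finset ℕ) (v : ℕ) : Prop :=
  I.Nonempty ∧ I ⊆ D.verts ∧
  (∀ x ∈ I, ∀ y ∈ I, (x, y) ∉ D.arcs) ∧
  (v ∈ I ∨ v ∉ D.verts) ∧
  D'.verts = (D.verts \ I) ∪ {v} ∧
  D'.arcs = D.arcs.filter (fun a => a.1 ∉ I ∧ a.2 ∉ I) ∪
      (D.arcs.filter (fun a => a.1 ∈ I ∧ a.2 ∉ I)).image (fun a => (v, a.2)) ∪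
      (D.arcs.filter (fun a => a.1 ∉ I ∧ a.2 ∈ I)).image (fun a => (a.1, v))

/-- Isomorphism of digraphs. -/
def Iso (D D' : Digr) : Prop :=
  ∃ f : ℕ → ℕ, Set.BijOn f ↑D.verts ↑D'.verts ∧
    ∀ x ∈ D.verts, ∀ y ∈ D.verts, ((x, y) ∈ D.arcs ↔ (f x, f y) ∈ D'.arcs)

/-- The Hajós-`k`-constructible digraphs: the smallest family of digraphs (closed
under isomorphism) containing the bidirected complete graph on `k` vertices and
closed under directed Hajós joins and identification of independent sets. -/
inductive HajosConstr (k : ℕ) : Digr → Prop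
  | base (D : Digr) : D.verts.card = k → D.IsBidirComplete → HajosConstr k D
  | join (D D1 D2 : Digr) (u1 v1 v2 u2 : ℕ) :
      HajosConstr k D1 → HajosConstr k D2 →
      IsHajosJoin D D1 D2 u1 v1 v2 u2 → HajosConstr k D
  | ident (D' D : Digr) (I : Finset ℕ) (v : ℕ) :
      HajosConstr k D → IsIdent D' D I v → HajosConstr k D'
  | iso (D D' : Digr) : HajosConstr k D → Iso D D' → HajosConstr k D'

/-- `D` is a directed Ore join of the disjoint digraphs `D1` and `D2`: a directed
Hajós join followed by identifying each `w` in a set `A1 ⊆ V(D1 - v1)` with `ι w`,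
where `ι` is a bijection from `A1` onto a subset of `V(D2 - v2)` with `ι u1 ≠ u2`. -/
def IsOreJoin (D D1 D2 : Digr) (u1 v1 v2 u2 : ℕ) : Prop :=
  ∃ (H : Digr) (A1 : Finset ℕ) (ι : ℕ → ℕ),
    IsHajosJoin H D1 D2 u1 v1 v2 u2 ∧
    A1 ⊆ D1.verts.erase v1 ∧
    A1.image ι ⊆ D2.verts.erase v2 ∧
    Set.InjOn ι ↑A1 ∧
    (u1 ∈ A1 → ι u1 ≠ u2) ∧
    D.verts = H.verts.image (fun x => if x ∈ A1 then ι x else x) ∧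
    D.arcs = H.arcs.image
      (Prod.map (fun x => if x ∈ A1 then ι x else x) (fun x => if x ∈ A1 then ι x else x))

/-- `D` is a bidirected Ore join of the disjoint digraphs `D1` and `D2`: a bidirected
Hajós join followed by the same kind of identification as in the directed Ore join. -/
def IsBidirOreJoin (D D1 D2 : Digr) (u1 v1 v2 u2 : ℕ) : Prop :=
  ∃ (H : Digr) (A1 : Finset ℕ) (ι : ℕ → ℕ),
    IsBidirHajosJoin H D1 D2 u1 v1 v2 u2 ∧
    A1 ⊆ D1.verts.erase v1 ∧
    A1.image ι ⊆ D2.verts.erase v2 ∧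
    Set.InjOn ι ↑A1 ∧
    (u1 ∈ A1 → ι u1 ≠ u2) ∧
    D.verts = H.verts.image (fun x => if x ∈ A1 then ι x else x) ∧
    D.arcs = H.arcs.image
      (Prod.map (fun x => if x ∈ A1 then ι x else x) (fun x => if x ∈ A1 then ι x else x))

/-- The Ore-`k`-constructible digraphs: the smallest family of digraphs (closed under
isomorphism) containing the bidirected complete graph on `k` vertices and closed
under directed and bidirected Ore joins. -/
inductive OreConstr (k : ℕ) : Digr → Prop
  | base (D : Digr) : D.verts.card = k → D.IsBidirComplete → OreConstr k D
  | dirJoin (D D1 D2 : Digr) (u1 v1 v2 u2 : ℕ) :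
      OreConstr k D1 → OreConstr k D2 →
      IsOreJoin D D1 D2 u1 v1 v2 u2 → OreConstr k D
  | bidirJoin (D D1 D2 : Digr) (u1 v1 v2 u2 : ℕ) :
      OreConstr k D1 → OreConstr k D2 →
      IsBidirOreJoin D D1 D2 u1 v1 v2 u2 → OreConstr k D
  | iso (D D' : Digr) : OreConstr k D → Iso D D' → OreConstr k D'

/-- The set of low vertices of `D` (for the parameter `k`): the vertices with
out-degree and in-degree both equal to `k - 1`. -/
def lowVerts (D : Digr) (k : ℕ) : Finset ℕ :=
  D.verts.filter (fun v => D.outDeg v = k - 1 ∧ D.inDeg v = k - 1)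

end Digr

namespace HJ

/-- No monochromatic closed walk along the arc set `A`. -/
def Good {n : ℕ} (A : Set (ℕ × ℕ)) (φ : ℕ → Fin n) : Prop :=
  ∀ v, ¬ Relation.TransGen (fun x y => (x, y) ∈ A ∧ φ x = φ y) v v

def Col (A : Set (ℕ × ℕ)) (n : ℕ) : Prop := ∃ φ : ℕ → Fin n, Good A φ

lemma Good.hom {n m : ℕ} {A B : Set (ℕ × ℕ)} {φ : ℕ → Fin n} {ψ : ℕ → Fin m} (hB : Good B ψ)
    (f : ℕ → ℕ)
    (h : ∀ x y, (x, y) ∈ A → φ x = φ y → (f x, f y) ∈ B ∧ ψ (f x) = ψ (f y)) : Good A φ := by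
  intro v hv
  exact hB (f v) (Relation.TransGen.lift f (fun a b hab => h a b hab.1 hab.2) _ _ hv)

lemma Good.mono {n m : ℕ} {A B : Set (ℕ × ℕ)} {φ : ℕ → Fin n} {ψ : ℕ → Fin m} (hB : Good B ψ)
    (h : ∀ x y, (x, y) ∈ A → φ x = φ y → (x, y) ∈ B ∧ ψ x = ψ y) : Good A φ :=
  hB.hom id h

lemma Col.sub {n : ℕ} {A B : Set (ℕ × ℕ)} (hB : Col B n) (h : A ⊆ B) : Col A n := by
  obtain ⟨φ, hφ⟩ := hB
  exact ⟨φ, hφ.mono fun x y hx he => ⟨h hx, he⟩⟩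

lemma Col.le {n m : ℕ} {A : Set (ℕ × ℕ)} (hB : Col A n) (h : n ≤ m) : Col A m := by
  obtain ⟨φ, hφ⟩ := hB
  refine ⟨fun x => Fin.castLE h (φ x), hφ.mono fun x y hx he => ⟨hx, ?_⟩⟩
  simpa using he

/-- Adding an arc. -/
lemma Good.add {n : ℕ} {B : Set (ℕ × ℕ)} {φ : ℕ → Fin n} (hB : Good B φ) (b a : ℕ)
    (h : φ b = φ a → ¬ Relation.ReflTransGen (fun x y => (x, y) ∈ B ∧ φ x = φ y) a b) :
    Good (B ∪ {(b, a)}) φ := by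
  have key : ∀ x y, Relation.TransGen (fun x y => (x, y) ∈ B ∪ {(b, a)} ∧ φ x = φ y) x y →
      Relation.TransGen (fun x y => (x, y) ∈ B ∧ φ x = φ y) x y ∨
      (φ b = φ a ∧ Relation.ReflTransGen (fun x y => (x, y) ∈ B ∧ φ x = φ y) x b ∧
        Relation.ReflTransGen (fun x y => (x, y) ∈ B ∧ φ x = φ y) a y) := by
    intro x y hxy
    induction hxy with
    | single hs =>
      obtain ⟨h1 | h1, he⟩ := hs
      · exact Or.inl (.single ⟨h1, he⟩)
      · obtain ⟨rfl, rfl⟩ := Prod.mk.inj h1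
        exact Or.inr ⟨he, .refl, .refl⟩
    | tail _ hs ih =>
      obtain ⟨h1 | h1, he⟩ := hs
      · rcases ih with ih | ⟨e, i1, i2⟩
        · exact Or.inl (ih.tail ⟨h1, he⟩)
        · exact Or.inr ⟨e, i1, i2.tail ⟨h1, he⟩⟩
      · obtain ⟨rfl, rfl⟩ := Prod.mk.inj h1
        rcases ih with ih | ⟨e, i1, i2⟩
        · exact Or.inr ⟨he, ih.to_reflTransGen, .refl⟩
        · exact absurd i2 (h e)
  intro v hv
  rcases key v v hv with h' | ⟨e, i1, i2⟩
  · exact hB v h'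
  · exact h e (i2.trans i1)

/-- Walks in a union of two arc sets that share only `v`. -/
lemma glue_walk {n : ℕ} {B1 B2 : Set (ℕ × ℕ)} {V1 V2 : Set ℕ} {v : ℕ} {φ : ℕ → Fin n}
    (hV : ∀ x, x ∈ V1 → x ∈ V2 → x = v)
    (s1 : ∀ x y, (x, y) ∈ B1 → x ∈ V1 ∧ y ∈ V1) (s2 : ∀ x y, (x, y) ∈ B2 → x ∈ V2 ∧ y ∈ V2)
    (g2 : Good B2 φ) {x y : ℕ} (hx : x ∈ V1)
    (h : Relation.TransGen (fun x y => (x, y) ∈ B1 ∪ B2 ∧ φ x = φ y) x y) :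
    (y ∈ V1 ∧ Relation.TransGen (fun x y => (x, y) ∈ B1 ∧ φ x = φ y) x y) ∨
    (y ∈ V2 ∧ Relation.ReflTransGen (fun x y => (x, y) ∈ B1 ∧ φ x = φ y) x v ∧
      Relation.TransGen (fun x y => (x, y) ∈ B2 ∧ φ x = φ y) v y) := by
  induction h with
  | single hs =>
    obtain ⟨h1 | h1, he⟩ := hs
    · exact Or.inl ⟨(s1 _ _ h1).2, .single ⟨h1, he⟩⟩
    · obtain rfl := hV _ hx (s2 _ _ h1).1
      exact Or.inr ⟨(s2 _ _ h1).2, .refl, .single ⟨h1, he⟩⟩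
  | tail _ hs ih =>
    obtain ⟨h1 | h1, he⟩ := hs
    · rcases ih with ⟨i0, i1⟩ | ⟨i0, i1, i2⟩
      · exact Or.inl ⟨(s1 _ _ h1).2, i1.tail ⟨h1, he⟩⟩
      · obtain rfl := hV _ (s1 _ _ h1).1 i0
        exact absurd i2 (g2 _)
    · rcases ih with ⟨i0, i1⟩ | ⟨i0, i1, i2⟩
      · obtain rfl := hV _ i0 (s2 _ _ h1).1
        exact Or.inr ⟨(s2 _ _ h1).2, i1.to_reflTransGen, .single ⟨h1, he⟩⟩
      · exact Or.inr ⟨(s2 _ _ h1).2, i1, i2.tail ⟨h1, he⟩⟩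

lemma glue_good {n : ℕ} {B1 B2 : Set (ℕ × ℕ)} {V1 V2 : Set ℕ} {v : ℕ} {φ : ℕ → Fin n}
    (hV : ∀ x, x ∈ V1 → x ∈ V2 → x = v)
    (s1 : ∀ x y, (x, y) ∈ B1 → x ∈ V1 ∧ y ∈ V1) (s2 : ∀ x y, (x, y) ∈ B2 → x ∈ V2 ∧ y ∈ V2)
    (g1 : Good B1 φ) (g2 : Good B2 φ) : Good (B1 ∪ B2) φ := by
  intro x hx
  obtain ⟨y, ⟨hxy | hxy, -⟩, -⟩ := Relation.TransGen.head'_iff.1 hx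
  · have hx1 := (s1 _ _ hxy).1
    rcases glue_walk hV s1 s2 g2 hx1 hx with ⟨_, i⟩ | ⟨i0, _, i⟩
    · exact g1 _ i
    · obtain rfl := hV _ hx1 i0
      exact g2 _ i
  · have hx2 := (s2 _ _ hxy).1
    rw [Set.union_comm] at hx
    rcases glue_walk (fun x a b => hV x b a) s2 s1 g1 hx2 hx with ⟨_, i⟩ | ⟨i0, _, i⟩
    · exact g2 _ i
    · obtain rfl := hV _ i0 hx2
      exact g1 _ i

/-- Gluing two colorings at `v` (after permuting colors in the second one). -/
lemma merge {n : ℕ} {B1 B2 : Set (ℕ × ℕ)} {V1 V2 : Set ℕ} {v : ℕ} {φ1 φ2 : ℕ → Fin n}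
    (hV : ∀ x, x ∈ V1 → x ∈ V2 → x = v) (hv1 : v ∈ V1)
    (s1 : ∀ x y, (x, y) ∈ B1 → x ∈ V1 ∧ y ∈ V1) (s2 : ∀ x y, (x, y) ∈ B2 → x ∈ V2 ∧ y ∈ V2)
    (g1 : Good B1 φ1) (g2 : Good B2 φ2) :
    ∃ φ : ℕ → Fin n, (∀ x ∈ V1, φ x = φ1 x) ∧
      (∀ x ∈ V2, ∀ y ∈ V2, φ x = φ y ↔ φ2 x = φ2 y) ∧ Good B1 φ ∧ Good B2 φ ∧
      Good (B1 ∪ B2) φ := by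
  classical
  let σ := Equiv.swap (φ2 v) (φ1 v)
  let φ : ℕ → Fin n := fun x => if x ∈ V1 then φ1 x else σ (φ2 x)
  have e1 : ∀ x ∈ V1, φ x = φ1 x := fun x hx => by simp [φ, hx]
  have e2 : ∀ x ∈ V2, φ x = σ (φ2 x) := fun x hx => by
    by_cases h : x ∈ V1
    · obtain rfl := hV _ h hx
      simp [φ, h, σ]
    · simp [φ, h]
  have e3 : ∀ x ∈ V2, ∀ y ∈ V2, φ x = φ y ↔ φ2 x = φ2 y := fun x hx y hy => by
    rw [e2 x hx, e2 y hy]; exact σ.injective.eq_iff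
  have G1 : Good B1 φ := g1.mono fun x y hx he => by
    rw [e1 x (s1 _ _ hx).1, e1 y (s1 _ _ hx).2] at he
    exact ⟨hx, he⟩
  have G2 : Good B2 φ := g2.mono fun x y hx he =>
    ⟨hx, (e3 x (s2 _ _ hx).1 y (s2 _ _ hx).2).1 he⟩
  exact ⟨φ, e1, e3, G1, G2, glue_good hV s1 s2 G1 G2⟩

/-- Arc-criticality. -/
def Crit (n : ℕ) (A : Set (ℕ × ℕ)) : Prop := ¬ Col A n ∧ ∀ a ∈ A, Col (A \ {a}) n

/-- The symmetric form of the data of a bidirected Hajós join. -/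
structure Data (n : ℕ) (A1 A2 : Set (ℕ × ℕ)) (V1 V2 : Set ℕ) (v u1 u2 : ℕ) : Prop where
  hV : ∀ x, x ∈ V1 → x ∈ V2 → x = v
  s1 : ∀ x y, (x, y) ∈ A1 → x ∈ V1 ∧ y ∈ V1
  s2 : ∀ x y, (x, y) ∈ A2 → x ∈ V2 ∧ y ∈ V2
  a1 : (u1, v) ∈ A1
  b1 : (v, u1) ∈ A1
  a2 : (u2, v) ∈ A2
  b2 : (v, u2) ∈ A2
  n1 : u1 ≠ v
  n2 : u2 ≠ v
  c1 : Crit n A1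
  c2 : Crit n A2

def J (A1 A2 : Set (ℕ × ℕ)) (v u1 u2 : ℕ) : Set (ℕ × ℕ) :=
  (A1 \ {(u1, v), (v, u1)}) ∪ (A2 \ {(u2, v), (v, u2)}) ∪ {(u1, u2), (u2, u1)}

lemma J_comm (A1 A2 : Set (ℕ × ℕ)) (v u1 u2 : ℕ) : J A1 A2 v u1 u2 = J A2 A1 v u2 u1 := by
  ext p; simp only [J, Set.mem_union, Set.mem_insert_iff, Set.mem_singleton_iff]; tauto

lemma Data.symm {n : ℕ} {A1 A2 : Set (ℕ × ℕ)} {V1 V2 : Set ℕ} {v u1 u2 : ℕ}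
    (d : Data n A1 A2 V1 V2 v u1 u2) : Data n A2 A1 V2 V1 v u2 u1 :=
  ⟨fun x a b => d.hV x b a, d.s2, d.s1, d.a2, d.b2, d.a1, d.b1, d.n2, d.n1, d.c2, d.c1⟩

/-- If a coloring is good without some arcs of the digon, then it is monochromatic on the digon. -/
lemma mono_of {n : ℕ} {A B : Set (ℕ × ℕ)} {u v : ℕ} (hA : ¬ Col A n)
    {φ : ℕ → Fin n} (g : Good B φ) (h : A \ {(u, v), (v, u)} ⊆ B) : φ u = φ v := by
  by_contra hne
  refine hA ⟨φ, g.mono fun x y hx he => ⟨h ⟨hx, ?_⟩, he⟩⟩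
  rintro (h' | h')
  · obtain ⟨rfl, rfl⟩ := Prod.mk.inj h'
    exact hne he
  · obtain ⟨rfl, rfl⟩ := Prod.mk.inj h'
    exact hne he.symm

lemma J_not_col {n : ℕ} {A1 A2 : Set (ℕ × ℕ)} {V1 V2 : Set ℕ} {v u1 u2 : ℕ}
    (d : Data n A1 A2 V1 V2 v u1 u2) : ¬ Col (J A1 A2 v u1 u2) n := by
  rintro ⟨φ, g⟩
  have e1 : φ u1 = φ v := mono_of d.c1.1 g fun p hp => Or.inl (Or.inl hp)
  have e2 : φ u2 = φ v := mono_of d.c2.1 g fun p hp => Or.inl (Or.inr hp)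
  refine g u1 (.tail (.single (b := u2) ⟨Or.inr (by simp), ?_⟩) ⟨Or.inr (by simp), ?_⟩)
  · rw [e1, e2]
  · rw [e1, e2]

lemma J_del_new {n : ℕ} {A1 A2 : Set (ℕ × ℕ)} {V1 V2 : Set ℕ} {v u1 u2 : ℕ}
    (d : Data n A1 A2 V1 V2 v u1 u2) : Col (J A1 A2 v u1 u2 \ {(u1, u2)}) n := by
  obtain ⟨φ1, g1⟩ := d.c1.2 _ d.a1
  obtain ⟨φ2, g2⟩ := d.c2.2 _ d.a2
  obtain ⟨φ, -, -, G1, G2, G⟩ := merge (v := v) d.hV (d.s1 _ _ d.a1).2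
    (fun x y h => d.s1 x y h.1) (fun x y h => d.s2 x y h.1) g1 g2
  refine Col.sub ⟨φ, G.add u2 u1 ?_⟩ ?_
  · intro _ hw
    rcases Relation.reflTransGen_iff_eq_or_transGen.1 hw with h | h
    · exact d.n2 (d.hV _ (h ▸ (d.s1 _ _ d.a1).1) (d.s2 _ _ d.a2).1)
    · rcases glue_walk d.hV (fun x y h => d.s1 x y h.1) (fun x y h => d.s2 x y h.1) G2
        (d.s1 _ _ d.a1).1 h with ⟨i0, _⟩ | ⟨_, i1, _⟩
      · exact d.n2 (d.hV _ i0 (d.s2 _ _ d.a2).1)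
      · have he : φ u1 = φ v := by
          clear * - i1
          generalize A1 \ {(u1, v)} = B at i1
          induction i1 with
          | refl => rfl
          | tail _ h ih => exact ih.trans h.2
        refine G1 v (Relation.TransGen.head' ⟨⟨d.b1, ?_⟩, he.symm⟩ i1)
        intro h
        exact d.n1 (Prod.mk.inj h).1.symm
  · rintro p ⟨(⟨hp, h'⟩ | ⟨hp, h'⟩) | hp, hne⟩
    · exact Or.inl (Or.inl ⟨hp, fun h => h' (Or.inl h)⟩)
    · exact Or.inl (Or.inr ⟨hp, fun h => h' (Or.inl h)⟩)
    · rcases hp with hp | hp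
      · exact absurd hp hne
      · exact Or.inr hp

lemma J_del_old {n : ℕ} {A1 A2 : Set (ℕ × ℕ)} {V1 V2 : Set ℕ} {v u1 u2 : ℕ}
    (d : Data n A1 A2 V1 V2 v u1 u2) (a : ℕ × ℕ) (ha : a ∈ A1 \ {(u1, v), (v, u1)}) :
    Col (J A1 A2 v u1 u2 \ {a}) n := by
  obtain ⟨φ1, g1⟩ := d.c1.2 _ ha.1
  obtain ⟨φ2, g2⟩ := d.c2.2 _ d.a2
  have hv1 := (d.s1 _ _ d.a1).2
  have hu1 := (d.s1 _ _ d.a1).1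
  have hv2 := (d.s2 _ _ d.a2).2
  have hu2 := (d.s2 _ _ d.a2).1
  obtain ⟨φ, e1, e2, G1, G2, G⟩ := merge (v := v) d.hV hv1
    (fun x y h => d.s1 x y h.1) (fun x y h => d.s2 x y h.1) g1 g2
  have m2 : φ u2 = φ v := mono_of d.c2.1 G2 fun p hp => ⟨hp.1, fun h => hp.2 (Or.inl h)⟩
  have m1 : φ u1 ≠ φ v := by
    intro he
    refine G1 u1 (.tail (.single (b := v) ⟨⟨d.a1, ?_⟩, he⟩) ⟨⟨d.b1, ?_⟩, he.symm⟩)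
    · exact fun h => ha.2 (Or.inl h.symm)
    · exact fun h => ha.2 (Or.inr h.symm)
  have ne : φ u1 ≠ φ u2 := by rw [m2]; exact m1
  refine Col.sub ⟨φ, (G.add u1 u2 fun h => absurd h ne).add u2 u1 fun h => absurd h.symm ne⟩ ?_
  rintro p ⟨(⟨hp, h'⟩ | ⟨hp, h'⟩) | hp, hne⟩
  · exact Or.inl (Or.inl (Or.inl ⟨hp, hne⟩))
  · exact Or.inl (Or.inl (Or.inr ⟨hp, fun h => h' (Or.inl h)⟩))
  · rcases hp with hp | hp
    · exact Or.inl (Or.inr hp)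
    · exact Or.inr hp

lemma J_crit {n : ℕ} {A1 A2 : Set (ℕ × ℕ)} {V1 V2 : Set ℕ} {v u1 u2 : ℕ}
    (d : Data n A1 A2 V1 V2 v u1 u2) : Crit n (J A1 A2 v u1 u2) := by
  refine ⟨J_not_col d, ?_⟩
  rintro a ((ha | ha) | rfl | rfl)
  · exact J_del_old d a ha
  · rw [J_comm]; exact J_del_old d.symm a ha
  · exact J_del_new d
  · rw [J_comm]; exact J_del_new d.symm

lemma J_cover {n : ℕ} {A1 A2 : Set (ℕ × ℕ)} {V1 V2 : Set ℕ} {v u1 u2 : ℕ} (hn : 2 ≤ n)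
    (d : Data n A1 A2 V1 V2 v u1 u2) (x : ℕ) (a : ℕ × ℕ) (ha : a ∈ A1) (hx : x = a.1 ∨ x = a.2) :
    ∃ a ∈ J A1 A2 v u1 u2, x = a.1 ∨ x = a.2 := by
  by_cases hd : a ∈ ({(u1, v), (v, u1)} : Set (ℕ × ℕ))
  swap
  · exact ⟨a, Or.inl (Or.inl ⟨ha, hd⟩), hx⟩
  have hx' : x = u1 ∨ x = v := by
    rcases hd with rfl | rfl
    · exact hx
    · exact hx.symm
  rcases hx' with rfl | rfl
  · exact ⟨(x, u2), Or.inr (by simp), Or.inl rfl⟩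
  by_contra hcon
  push Not at hcon
  obtain ⟨φ, g⟩ := d.c1.2 _ d.a1
  have : Nontrivial (Fin n) := Fin.nontrivial_iff_two_le.2 hn
  obtain ⟨c, hc⟩ := exists_ne (φ u1)
  refine d.c1.1 ⟨Function.update φ x c, g.mono fun y z hy he => ?_⟩
  by_cases hD : (y, z) ∈ ({(u1, x), (x, u1)} : Set (ℕ × ℕ))
  · exfalso
    rcases hD with h | h
    · obtain ⟨rfl, rfl⟩ := Prod.mk.inj h
      simp [Function.update_of_ne d.n1] at he
      exact hc he.symm
    · obtain ⟨rfl, rfl⟩ := Prod.mk.inj h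
      simp [Function.update_of_ne d.n1] at he
      exact hc he
  · obtain ⟨h1, h2⟩ := hcon (y, z) (Or.inl (Or.inl ⟨hy, hD⟩))
    rw [Function.update_of_ne h1.symm, Function.update_of_ne h2.symm] at he
    exact ⟨⟨hy, fun h => hD (Or.inl h)⟩, he⟩

/-- One more color suffices after putting an arc back. -/
lemma Crit.col_succ {n : ℕ} (hn : 1 ≤ n) {A : Set (ℕ × ℕ)} (h : Crit n A)
    (hl : ∀ x y, (x, y) ∈ A → x ≠ y) : Col A (n + 1) := by
  have hne : A.Nonempty := by
    by_contra he
    rw [Set.not_nonempty_iff_eq_empty] at he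
    subst he
    refine h.1 ⟨fun _ => ⟨0, hn⟩, fun v hv => ?_⟩
    obtain ⟨y, hy, -⟩ := Relation.TransGen.head'_iff.1 hv
    exact hy.1
  obtain ⟨⟨a, b⟩, hab⟩ := hne
  obtain ⟨φ, g⟩ := h.2 _ hab
  refine ⟨Function.update (fun x => (φ x).castSucc) a (Fin.last n), g.mono fun x y hx he => ?_⟩
  have hxy := hl x y hx
  by_cases h1 : x = a
  · subst h1
    rw [Function.update_self, Function.update_of_ne hxy.symm] at he
    exact absurd he.symm (Fin.castSucc_lt_last _).ne
  · by_cases h2 : y = a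
    · subst h2
      rw [Function.update_self, Function.update_of_ne hxy] at he
      exact absurd he (Fin.castSucc_lt_last _).ne
    · rw [Function.update_of_ne h1, Function.update_of_ne h2] at he
      exact ⟨⟨hx, fun h => h1 (Prod.mk.inj h).1⟩, Fin.castSucc_injective _ he⟩

lemma col_iff (D : Digr) (n : ℕ) : D.Colorable n ↔ Col (↑D.arcs) n := Iff.rfl

lemma dichrom_le {D : Digr} {n : ℕ} (h : Col (↑D.arcs) n) : D.dichrom ≤ n := Nat.sInf_le h

lemma col_dichrom {D : Digr} {n : ℕ} (h : Col (↑D.arcs) n) : Col (↑D.arcs) D.dichrom :=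
  Nat.sInf_mem (s := {n | D.Colorable n}) ⟨n, h⟩

lemma crit_fwd {n : ℕ} {D : Digr} (h : D.Critical (n + 1)) :
    Crit n (↑D.arcs) ∧ ∀ x ∈ D.verts, ∃ a ∈ D.arcs, x = a.1 ∨ x = a.2 := by
  obtain ⟨hd, hs⟩ := h
  have hcol : Col (↑D.arcs) (n + 1) := by
    have : D.dichrom ∈ {n | D.Colorable n} := by
      apply Nat.sInf_mem
      apply Nat.nonempty_of_pos_sInf
      change 0 < D.dichrom
      omega
    rw [hd] at this
    exact this
  refine ⟨⟨fun hc => ?_, fun a ha => ?_⟩, fun x hx => ?_⟩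
  · have := dichrom_le hc
    omega
  · have ha' : a ∈ D.arcs := ha
    let D' : Digr := ⟨D.verts, D.arcs.erase a, fun b hb => D.arcs_sub b (Finset.mem_of_mem_erase hb),
      fun b hb => D.no_loops b (Finset.mem_of_mem_erase hb)⟩
    have hsub : D'.Sub D := ⟨subset_rfl, Finset.erase_subset _ _⟩
    have hne : D' ≠ D := by
      intro h
      have : a ∈ D'.arcs := by rw [h]; exact ha'
      exact absurd this (Finset.notMem_erase a _)
    have hlt := hs D' hsub hne
    have hc : Col (↑D'.arcs) n :=
      (col_dichrom (hcol.sub (A := ↑D'.arcs) (by exact_mod_cast hsub.2))).le (by omega)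
    simpa [D'] using hc
  · by_contra hcon
    push Not at hcon
    let D' : Digr := ⟨D.verts.erase x, D.arcs, fun b hb =>
      ⟨Finset.mem_erase.2 ⟨(hcon b hb).1.symm, (D.arcs_sub b hb).1⟩,
       Finset.mem_erase.2 ⟨(hcon b hb).2.symm, (D.arcs_sub b hb).2⟩⟩, D.no_loops⟩
    have hne : D' ≠ D := by
      intro h
      have : x ∈ D'.verts := by rw [h]; exact hx
      exact absurd this (Finset.notMem_erase x _)
    have hlt := hs D' ⟨Finset.erase_subset _ _, subset_rfl⟩ hne
    have : D'.dichrom = D.dichrom := rfl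
    omega

lemma crit_bwd {n : ℕ} (hn : 1 ≤ n) {D : Digr} (h : Crit n (↑D.arcs))
    (hx : ∀ x ∈ D.verts, ∃ a ∈ D.arcs, x = a.1 ∨ x = a.2) : D.Critical (n + 1) := by
  have hcol := h.col_succ hn (fun x y hxy => D.no_loops _ hxy)
  refine ⟨le_antisymm (dichrom_le hcol) ?_, fun D' hsub hne => ?_⟩
  · by_contra hlt
    exact h.1 ((col_dichrom hcol).le (by omega))
  · by_cases he : D.arcs ⊆ D'.arcs
    · exfalso
      apply hne
      have hv : D.verts ⊆ D'.verts := by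
        intro x hxD
        obtain ⟨a, ha, h1 | h1⟩ := hx x hxD
        · rw [h1]; exact (D'.arcs_sub a (he ha)).1
        · rw [h1]; exact (D'.arcs_sub a (he ha)).2
      have e1 := hsub.1.antisymm hv
      have e2 := hsub.2.antisymm he
      cases D; cases D'
      simp only at e1 e2
      subst e1 e2
      rfl
    · obtain ⟨a, ha, ha'⟩ := Finset.not_subset.1 he
      have : Col (↑D'.arcs) n := (h.2 a ha).sub fun p hp =>
        ⟨hsub.2 hp, fun h => ha' (by rw [← Set.mem_singleton_iff.1 h]; exact hp)⟩
      exact Nat.lt_succ_of_le (dichrom_le this)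

/-- Relabelling of an arc set by a permutation. -/
def rel (σ : Equiv.Perm ℕ) (A : Set (ℕ × ℕ)) : Set (ℕ × ℕ) := {p | (σ p.1, σ p.2) ∈ A}

lemma Col.rel {n : ℕ} {A : Set (ℕ × ℕ)} (h : Col A n) (σ : Equiv.Perm ℕ) : Col (rel σ A) n := by
  obtain ⟨φ, g⟩ := h
  exact ⟨φ ∘ σ, g.hom σ fun x y hx he => ⟨hx, he⟩⟩

lemma Crit.rel {n : ℕ} {A : Set (ℕ × ℕ)} (h : Crit n A) (σ : Equiv.Perm ℕ) :
    Crit n (rel σ A) := by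
  refine ⟨fun hc => h.1 ?_, fun a ha => ?_⟩
  · refine (hc.rel σ⁻¹).sub fun p hp => ?_
    simpa [HJ.rel] using hp
  · refine ((h.2 _ ha).rel σ).sub fun p hp => ⟨hp.1, fun he => hp.2 ?_⟩
    obtain ⟨e1, e2⟩ := Prod.mk.inj he
    exact Prod.ext (σ.injective e1) (σ.injective e2)

end HJ

open Digr in
/-- If `D = D1 ▽̄ D2` is the bidirected Hajós join of the disjoint
non-empty digraphs `D1` and `D2`, `k ≥ 3`, and both `D1` and `D2` are `k`-critical,
then `D` is `k`-critical. -/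
theorem bidir_hajos_join_critical (D D1 D2 : Digr) (u1 v1 v2 u2 : ℕ) (k : ℕ)
    (h1 : D1.verts.Nonempty) (h2 : D2.verts.Nonempty)
    (hD : IsBidirHajosJoin D D1 D2 u1 v1 v2 u2)
    (hk : 3 ≤ k) (hc1 : D1.Critical k) (hc2 : D2.Critical k) :
    D.Critical k := by
  obtain ⟨hdis, a1, b1, a2, b2, hverts, harcs⟩ := hD
  obtain ⟨n, rfl⟩ : ∃ n, k = n + 1 := ⟨k - 1, by omega⟩
  obtain ⟨c1, i1⟩ := HJ.crit_fwd hc1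
  obtain ⟨c2, i2⟩ := HJ.crit_fwd hc2
  have hv1 := (D1.arcs_sub _ a1).2
  have hv2 := (D2.arcs_sub _ a2).2
  have hu1 := (D1.arcs_sub _ a1).1
  have hu2 := (D2.arcs_sub _ a2).1
  have n1 := D1.no_loops _ a1
  have n2 := D2.no_loops _ a2
  simp only at hv1 hv2 hu1 hu2 n1 n2
  have dj : ∀ x, x ∈ D1.verts → x ∈ D2.verts → False := fun x h h' =>
    Finset.disjoint_left.1 hdis h h'
  have hv12 : v1 ≠ v2 := fun h => dj v1 hv1 (h ▸ hv2)
  have hu2v1 : u2 ≠ v1 := fun h => dj v1 hv1 (h ▸ hu2)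
  let σ : Equiv.Perm ℕ := Equiv.swap v1 v2
  have σv1 : σ v1 = v2 := Equiv.swap_apply_left _ _
  have σv2 : σ v2 = v1 := Equiv.swap_apply_right _ _
  have σo : ∀ x, x ≠ v1 → x ≠ v2 → σ x = x := fun x => Equiv.swap_apply_of_ne_of_ne
  have σσ : ∀ x, σ (σ x) = x := fun x => Equiv.swap_apply_self _ _ _
  have σu2 : σ u2 = u2 := σo _ hu2v1 n2
  have hf : ∀ x ∈ D2.verts, (if x = v2 then v1 else x) = σ x := by
    intro x hx
    split_ifs with h
    · rw [h, σv2]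
    · exact (σo x (fun h' => dj v1 hv1 (h' ▸ hx)) h).symm
  have d : HJ.Data n (↑D1.arcs) (HJ.rel σ ↑D2.arcs) (↑D1.verts) {x | σ x ∈ D2.verts} v1 u1 u2 := by
    refine ⟨?_, ?_, ?_, a1, b1, ?_, ?_, n1, hu2v1, c1, c2.rel σ⟩
    · intro x hx hx'
      by_contra hne
      by_cases h : x = v2
      · exact dj v2 (h ▸ hx) hv2
      · have hx'' : σ x ∈ D2.verts := hx'
        rw [σo x hne h] at hx''
        exact dj x hx hx''
    · exact fun x y h => D1.arcs_sub _ h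
    · exact fun x y h => D2.arcs_sub _ h
    · change (σ u2, σ v1) ∈ D2.arcs
      rw [σu2, σv1]; exact a2
    · change (σ v1, σ u2) ∈ D2.arcs
      rw [σu2, σv1]; exact b2
  have hJ : (↑D.arcs : Set (ℕ × ℕ)) = HJ.J (↑D1.arcs) (HJ.rel σ ↑D2.arcs) v1 u1 u2 := by
    rw [harcs]
    have e1 : ((((D1.arcs.erase (u1, v1)).erase (v1, u1)) : Finset (ℕ × ℕ)) : Set (ℕ × ℕ)) =
        ↑D1.arcs \ {(u1, v1), (v1, u1)} := by
      ext p
      simp only [Finset.coe_erase, Set.mem_sdiff, Set.mem_insert_iff, Set.mem_singleton_iff]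
      tauto
    have e2 : ((((D2.arcs.erase (v2, u2)).erase (u2, v2)).image
        (Prod.map (fun x => if x = v2 then v1 else x) (fun x => if x = v2 then v1 else x)) :
          Finset (ℕ × ℕ)) : Set (ℕ × ℕ)) = HJ.rel σ ↑D2.arcs \ {(u2, v1), (v1, u2)} := by
      ext ⟨x, y⟩
      constructor
      · intro h
        obtain ⟨⟨a, b⟩, hab, he⟩ := Finset.mem_image.1 h
        obtain ⟨h3, h4, h5⟩ : (a, b) ≠ (u2, v2) ∧ (a, b) ≠ (v2, u2) ∧ (a, b) ∈ D2.arcs := by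
          simpa only [Finset.mem_erase] using hab
        have hs := D2.arcs_sub _ h5
        obtain ⟨ex, ey⟩ := Prod.mk.inj he
        replace ex : σ a = x := (hf a hs.1).symm.trans ex
        replace ey : σ b = y := (hf b hs.2).symm.trans ey
        subst ex ey
        refine ⟨?_, ?_⟩
        · change (σ (σ a), σ (σ b)) ∈ D2.arcs
          rw [σσ, σσ]; exact h5
        · rintro (h | h)
          · obtain ⟨e1, e2⟩ := Prod.mk.inj h
            apply h3
            rw [← σσ a, ← σσ b, e1, e2, σu2, σv1]
          · obtain ⟨e1, e2⟩ := Prod.mk.inj h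
            apply h4
            rw [← σσ a, ← σσ b, e1, e2, σu2, σv1]
      · rintro ⟨h, hne⟩
        have h' : (σ x, σ y) ∈ D2.arcs := h
        have hs := D2.arcs_sub _ h'
        refine Finset.mem_image.2 ⟨(σ x, σ y), ?_, ?_⟩
        · refine Finset.mem_erase.2 ⟨fun he => hne (Or.inl ?_), Finset.mem_erase.2
            ⟨fun he => hne (Or.inr ?_), h'⟩⟩
          · obtain ⟨e1, e2⟩ := Prod.mk.inj he
            rw [← σσ x, ← σσ y, e1, e2, σu2, σv2]
          · obtain ⟨e1, e2⟩ := Prod.mk.inj he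
            rw [← σσ x, ← σσ y, e1, e2, σu2, σv2]; rfl
        · refine Prod.ext ?_ ?_
          · exact (hf _ hs.1).trans (σσ x)
          · exact (hf _ hs.2).trans (σσ y)
    rw [Finset.coe_union, Finset.coe_union, e1, e2, HJ.J]
    simp
  refine HJ.crit_bwd (by omega) (hJ ▸ HJ.J_crit d) fun x hx => ?_
  have hn : 2 ≤ n := by omega
  suffices h : ∃ a ∈ (↑D.arcs : Set (ℕ × ℕ)), x = a.1 ∨ x = a.2 from h
  rw [hJ]
  rw [hverts] at hx
  rcases Finset.mem_union.1 hx with hx | hx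
  · obtain ⟨a, ha, hxa⟩ := i1 x hx
    exact HJ.J_cover hn d x a ha hxa
  · obtain ⟨hxv, hx⟩ := Finset.mem_erase.1 hx
    obtain ⟨a, ha, hxa⟩ := i2 x hx
    rw [HJ.J_comm]
    have hσx : σ x = x := σo x (fun h' => dj v1 hv1 (h' ▸ hx)) hxv
    refine HJ.J_cover hn d.symm x (σ a.1, σ a.2) ?_ ?_
    · change (σ (σ a.1), σ (σ a.2)) ∈ D2.arcs
      rw [σσ, σσ]; exact ha
    · rcases hxa with h | h
      · left; change x = σ a.1; rw [← h, hσx]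
      · right; change x = σ a.2; rw [← h, hσx]
end

section
/- Let k ≥ 3 be an integer. A digraph D has dichromatic number χ⃗(D) ≥ k if and only if D contains a Hajós-k-constructible subdigraph. -/
/-- Dilworth's theorem for finite subsets of a preorder (Galvin's proof). -/
theorem dilworth_aux {α : Type} [DecidableEq α] [Preorder α] (P : Finset α) :
    ∀ n : ℕ, (∀ A ⊆ P, (∀ x ∈ A, ∀ y ∈ A, x ≠ y → ¬ x ≤ y) → A.card ≤ n) →
    ∃ φ : α → ℕ, (∀ x ∈ P, φ x < n) ∧
      ∀ x ∈ P, ∀ y ∈ P, φ x = φ y → x ≤ y ∨ y ≤ x := by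
  classical
  induction P using Finset.strongInduction with
  | H P ih =>
  intro n hA
  rcases P.eq_empty_or_nonempty with rfl | hne
  · exact ⟨fun _ => 0, by simp, by simp⟩
  obtain ⟨a, haP, hamax⟩ := P.exists_maximal hne
  have hn : 1 ≤ n := by
    have := hA {a} (by simpa using haP) (by simp)
    simpa using this
  suffices h : ∃ K ⊆ P, a ∈ K ∧ (∀ x ∈ K, ∀ y ∈ K, x ≤ y ∨ y ≤ x) ∧
      ∀ A ⊆ P \ K, (∀ x ∈ A, ∀ y ∈ A, x ≠ y → ¬ x ≤ y) → A.card ≠ n by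
    obtain ⟨K, hKP, haK, hK, hKA⟩ := h
    have hss : P \ K ⊂ P := by
      refine Finset.ssubset_iff_subset_ne.2 ⟨Finset.sdiff_subset, fun h => ?_⟩
      rw [← h] at haP
      exact (Finset.mem_sdiff.1 haP).2 haK
    obtain ⟨ψ, h1, h2⟩ := ih _ hss (n - 1) (by
      intro A hAs hA'
      have := hA A (hAs.trans Finset.sdiff_subset) hA'
      have := hKA A hAs hA'
      omega)
    refine ⟨fun z => if z ∈ K then n - 1 else ψ z, ?_, ?_⟩
    · intro x hx
      by_cases hxK : x ∈ K
      · simp only [hxK, if_true]; omega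
      · have := h1 x (Finset.mem_sdiff.2 ⟨hx, hxK⟩)
        simp only [hxK, if_false]; omega
    · intro x hx y hy hxy
      by_cases hxK : x ∈ K <;> by_cases hyK : y ∈ K <;>
        simp only [hxK, hyK, if_true, if_false] at hxy
      · exact hK x hxK y hyK
      · have := h1 y (Finset.mem_sdiff.2 ⟨hy, hyK⟩); omega
      · have := h1 x (Finset.mem_sdiff.2 ⟨hx, hxK⟩); omega
      · exact h2 x (Finset.mem_sdiff.2 ⟨hx, hxK⟩) y (Finset.mem_sdiff.2 ⟨hy, hyK⟩) hxy
  by_cases hB : ∃ B ⊆ P.erase a, (∀ x ∈ B, ∀ y ∈ B, x ≠ y → ¬ x ≤ y) ∧ B.card = n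
  swap
  · push Not at hB
    refine ⟨{a}, by simpa using haP, by simp, by simp, ?_⟩
    intro A hAs
    exact hB A (by rwa [Finset.sdiff_singleton_eq_erase] at hAs)
  obtain ⟨B0, hB0P, hB0, hB0n⟩ := hB
  obtain ⟨φ, hφ, hφc⟩ := ih _ (Finset.erase_ssubset haP) n
    (fun A hAs => hA A (hAs.trans (Finset.erase_subset _ _)))
  have hit : ∀ B ⊆ P.erase a, (∀ x ∈ B, ∀ y ∈ B, x ≠ y → ¬ x ≤ y) → B.card = n →
      ∀ i < n, ∃ x ∈ B, φ x = i := by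
    intro B hBP hBa hBn i hi
    have hinj : Set.InjOn φ ↑B := by
      intro x hx y hy hxy
      by_contra hne
      rcases hφc x (hBP hx) y (hBP hy) hxy with h | h
      · exact hBa x hx y hy hne h
      · exact hBa y hy x hx (Ne.symm hne) h
    have him : B.image φ = Finset.range n := by
      apply Finset.eq_of_subset_of_card_le
      · intro j hj
        obtain ⟨x, hx, rfl⟩ := Finset.mem_image.1 hj
        exact Finset.mem_range.2 (hφ x (hBP hx))
      · rw [Finset.card_image_of_injOn hinj, hBn, Finset.card_range]
    have : i ∈ B.image φ := by rw [him]; exact Finset.mem_range.2 hi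
    simpa using this
  have hx : ∀ i, i < n → ∃ x ∈ P.erase a, φ x = i ∧
      (∃ B ⊆ P.erase a, (∀ x ∈ B, ∀ y ∈ B, x ≠ y → ¬ x ≤ y) ∧ B.card = n ∧ x ∈ B) ∧
      ∀ z ∈ P.erase a, φ z = i →
        (∃ B ⊆ P.erase a, (∀ x ∈ B, ∀ y ∈ B, x ≠ y → ¬ x ≤ y) ∧ B.card = n ∧ z ∈ B) →
        z ≤ x := by
    intro i hi
    obtain ⟨x, hxm⟩ := ((P.erase a).filter (fun z => φ z = i ∧
      ∃ B ⊆ P.erase a, (∀ x ∈ B, ∀ y ∈ B, x ≠ y → ¬ x ≤ y) ∧ B.card = n ∧ z ∈ B)).exists_maximal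
      (by
        obtain ⟨x, hx, hxi⟩ := hit B0 hB0P hB0 hB0n i hi
        exact ⟨x, Finset.mem_filter.2 ⟨hB0P hx, hxi, B0, hB0P, hB0, hB0n, hx⟩⟩)
    have h1 := Finset.mem_filter.1 hxm.1
    refine ⟨x, h1.1, h1.2.1, h1.2.2, ?_⟩
    intro z hz hzi hzB
    rcases hφc z hz x h1.1 (hzi.trans h1.2.1.symm) with h | h
    · exact h
    · exact hxm.2 (Finset.mem_filter.2 ⟨hz, hzi, hzB⟩) h
  have : Nonempty α := ⟨a⟩
  choose! x hxP hxi hxB hxmax using hx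
  have hanti : ∀ i < n, ∀ j < n, i ≠ j → ¬ x i ≤ x j := by
    intro i hi j hj hij hle
    obtain ⟨B, hBP, hBa, hBn, hmem⟩ := hxB j hj
    obtain ⟨y, hy, hyi⟩ := hit B hBP hBa hBn i hi
    have hyx := hxmax i hi y (hBP hy) hyi ⟨B, hBP, hBa, hBn, hy⟩
    refine hBa y hy (x j) hmem ?_ (hyx.trans hle)
    rintro rfl
    exact hij (hyi.symm.trans (hxi j hj))
  have hex : ∃ i < n, x i ≤ a := by
    by_contra hcon
    push Not at hcon
    have hinj : Set.InjOn x ↑(Finset.range n) := by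
      intro i hi j hj hij
      have h1 := hxi i (by simpa using hi)
      have h2 := hxi j (by simpa using hj)
      rw [← h1, ← h2, hij]
    have ha' : a ∉ (Finset.range n).image x := by
      intro h
      obtain ⟨i, hi, hia⟩ := Finset.mem_image.1 h
      exact hcon i (Finset.mem_range.1 hi) hia.le
    have := hA (insert a ((Finset.range n).image x)) (by
      intro z hz
      rcases Finset.mem_insert.1 hz with rfl | hz
      · exact haP
      · obtain ⟨i, hi, rfl⟩ := Finset.mem_image.1 hz
        exact Finset.mem_of_mem_erase (hxP i (Finset.mem_range.1 hi))) (by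
      intro p hp q hq hpq hle
      rcases Finset.mem_insert.1 hp with hp' | hp' <;>
        rcases Finset.mem_insert.1 hq with hq' | hq'
      · exact hpq (hp'.trans hq'.symm)
      · obtain ⟨i, hi, rfl⟩ := Finset.mem_image.1 hq'
        have hi := Finset.mem_range.1 hi
        rw [hp'] at hle
        exact hcon i hi (hamax (Finset.mem_of_mem_erase (hxP i hi)) hle)
      · obtain ⟨i, hi, rfl⟩ := Finset.mem_image.1 hp'
        rw [hq'] at hle
        exact hcon i (Finset.mem_range.1 hi) hle
      · obtain ⟨i, hi, rfl⟩ := Finset.mem_image.1 hp'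
        obtain ⟨j, hj, rfl⟩ := Finset.mem_image.1 hq'
        exact hanti i (Finset.mem_range.1 hi) j (Finset.mem_range.1 hj)
          (fun h => hpq (by rw [h])) hle)
    rw [Finset.card_insert_of_notMem ha', Finset.card_image_of_injOn hinj,
      Finset.card_range] at this
    omega
  obtain ⟨i, hi, hia⟩ := hex
  refine ⟨insert a ((P.erase a).filter (fun z => φ z = i ∧ z ≤ x i)), ?_,
    Finset.mem_insert_self _ _, ?_, ?_⟩
  · intro z hz
    rcases Finset.mem_insert.1 hz with rfl | hz
    · exact haP
    · exact Finset.mem_of_mem_erase (Finset.mem_filter.1 hz).1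
  · intro p hp q hq
    rcases Finset.mem_insert.1 hp with hp' | hp' <;>
        rcases Finset.mem_insert.1 hq with hq' | hq'
    · rw [hp', hq']; exact Or.inl le_rfl
    · rw [hp']; exact Or.inr ((Finset.mem_filter.1 hq').2.2.trans hia)
    · rw [hq']; exact Or.inl ((Finset.mem_filter.1 hp').2.2.trans hia)
    · have h1 := Finset.mem_filter.1 hp'
      have h2 := Finset.mem_filter.1 hq'
      exact hφc p h1.1 q h2.1 (h1.2.1.trans h2.2.1.symm)
  · intro A hAs hAa hAn
    have hAP : A ⊆ P.erase a := by
      intro z hz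
      have h := Finset.mem_sdiff.1 (hAs hz)
      refine Finset.mem_erase.2 ⟨?_, h.1⟩
      rintro rfl
      exact h.2 (Finset.mem_insert_self _ _)
    obtain ⟨z, hz, hzi⟩ := hit A hAP hAa hAn i hi
    have h := Finset.mem_sdiff.1 (hAs hz)
    exact h.2 (Finset.mem_insert_of_mem (Finset.mem_filter.2
      ⟨hAP hz, hzi, hxmax i hi z (hAP hz) hzi ⟨A, hAP, hAa, hAn, hz⟩⟩))

namespace Digr

theorem tlift {S R : ℕ → ℕ → Prop} (f : ℕ → ℕ) (h : ∀ x y, S x y → R (f x) (f y)) {a b : ℕ}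
    (hab : Relation.TransGen S a b) : Relation.TransGen R (f a) (f b) := by
  induction hab with
  | single hs => exact .single (h _ _ hs)
  | tail _ hs ih => exact ih.tail (h _ _ hs)

theorem rlift {S R : ℕ → ℕ → Prop} (f : ℕ → ℕ) (h : ∀ x y, S x y → R (f x) (f y)) {a b : ℕ}
    (hab : Relation.ReflTransGen S a b) : Relation.ReflTransGen R (f a) (f b) := by
  induction hab with
  | refl => exact .refl
  | tail _ hs ih => exact ih.tail (h _ _ hs)

theorem transGen_split {S R : ℕ → ℕ → Prop} {u v : ℕ}
    (h : ∀ x y, S x y → R x y ∨ (x = u ∧ y = v)) {a b : ℕ} (hab : Relation.TransGen S a b) :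
    Relation.TransGen R a b ∨ (Relation.ReflTransGen R a u ∧ Relation.ReflTransGen R v b) := by
  induction hab with
  | single hs =>
    rcases h _ _ hs with h | ⟨rfl, rfl⟩
    · exact Or.inl (.single h)
    · exact Or.inr ⟨.refl, .refl⟩
  | tail _ hs ih =>
    rcases h _ _ hs with h | ⟨rfl, rfl⟩
    · rcases ih with ih | ⟨h1, h2⟩
      · exact Or.inl (ih.tail h)
      · exact Or.inr ⟨h1, h2.tail h⟩
    · rcases ih with ih | ⟨h1, h2⟩
      · exact Or.inr ⟨ih.to_reflTransGen, .refl⟩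
      · exact Or.inr ⟨h1, .refl⟩

theorem mono_color {n : ℕ} {A : Finset (ℕ × ℕ)} {φ : ℕ → Fin n} {a b : ℕ}
    (h : Relation.ReflTransGen (fun x y => (x, y) ∈ A ∧ φ x = φ y) a b) : φ a = φ b := by
  induction h with
  | refl => rfl
  | tail _ h ih => exact ih.trans h.2

theorem Colorable.of_sub {D' D : Digr} {n : ℕ} (hs : D'.arcs ⊆ D.arcs) (h : D.Colorable n) :
    D'.Colorable n := by
  obtain ⟨φ, hφ⟩ := h
  exact ⟨φ, fun v hv => hφ v (tlift id (fun x y h => ⟨hs h.1, h.2⟩) hv)⟩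

theorem Colorable.mono {D : Digr} {n m : ℕ} (hnm : n ≤ m) (h : D.Colorable n) :
    D.Colorable m := by
  obtain ⟨φ, hφ⟩ := h
  exact ⟨fun x => Fin.castLE hnm (φ x), fun v hv => hφ v
    (tlift id (fun x y h => ⟨h.1, Fin.castLE_injective hnm h.2⟩) hv)⟩

theorem exists_colorable (D : Digr) : ∃ n, D.Colorable n := by
  refine ⟨D.verts.sup id + 1, fun x => ⟨x % (D.verts.sup id + 1), Nat.mod_lt _ (by omega)⟩, ?_⟩
  intro v hv
  have key : ∀ x y, ¬ ((x, y) ∈ D.arcs ∧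
      (⟨x % (D.verts.sup id + 1), Nat.mod_lt _ (by omega)⟩ : Fin (D.verts.sup id + 1)) =
      ⟨y % (D.verts.sup id + 1), Nat.mod_lt _ (by omega)⟩) := by
    rintro x y ⟨hxy, h⟩
    have h1 := D.arcs_sub _ hxy
    have h2 := D.no_loops _ hxy
    have hx : x ≤ D.verts.sup id := Finset.le_sup (f := id) h1.1
    have hy : y ≤ D.verts.sup id := Finset.le_sup (f := id) h1.2
    rw [Fin.mk.injEq, Nat.mod_eq_of_lt (by omega), Nat.mod_eq_of_lt (by omega)] at h
    exact h2 h
  obtain ⟨_, h, _⟩ := Relation.TransGen.head'_iff.1 hv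
  exact key _ _ h

/-- A coloring pulls back along arc-preserving maps. -/
theorem Colorable.of_hom {D' D : Digr} {n : ℕ} (f : ℕ → ℕ)
    (hf : ∀ x y, (x, y) ∈ D.arcs → (f x, f y) ∈ D'.arcs) (h : D'.Colorable n) :
    D.Colorable n := by
  obtain ⟨φ, hφ⟩ := h
  refine ⟨fun x => φ (f x), fun v hv => hφ (f v) ?_⟩
  exact tlift f (fun x y h => ⟨hf x y h.1, h.2⟩) hv

theorem HajosConstr.not_colorable {k : ℕ} (hk : 3 ≤ k) {D : Digr} (h : HajosConstr k D) :
    ¬ D.Colorable (k - 1) := by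
  induction h with
  | base D hc hb =>
    rintro ⟨φ, hφ⟩
    obtain ⟨x, hx, y, hy, hne, hxy⟩ := Finset.exists_ne_map_eq_of_card_lt_of_maps_to
      (s := D.verts) (t := (Finset.univ : Finset (Fin (k - 1)))) (f := φ)
      (by rw [hc, Finset.card_univ, Fintype.card_fin]; omega) (by simp)
    have h1 : (x, y) ∈ D.arcs := by rw [hb]; simp [hx, hy, hne]
    have h2 : (y, x) ∈ D.arcs := by rw [hb]; simp [hx, hy, hne.symm]
    exact hφ x (.tail (.single ⟨h1, hxy⟩) ⟨h2, hxy.symm⟩)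
  | join D D1 D2 u1 v1 v2 u2 _ _ hj ih1 ih2 =>
    rintro ⟨φ, hφ⟩
    obtain ⟨hdisj, ha1, ha2, hV, hA⟩ := hj
    set g : ℕ → ℕ := fun x => if x = v2 then v1 else x with hg
    have hu2 : g u2 = u2 := by
      have := D2.no_loops _ ha2
      simp only [hg]; rw [if_neg]; exact fun h => this h.symm
    have hv2 : g v2 = v1 := by simp [hg]
    have p1 : Relation.ReflTransGen (fun x y => (x, y) ∈ D.arcs ∧ φ x = φ y) v1 u1 := by
      by_contra hcon
      have hsp : ∀ x y, ((x, y) ∈ D1.arcs ∧ φ x = φ y) →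
          ((x, y) ∈ D.arcs ∧ φ x = φ y) ∨ (x = u1 ∧ y = v1) := by
        intro x y h
        by_cases hxy : (x, y) = (u1, v1)
        · exact Or.inr (by simpa using hxy)
        · refine Or.inl ⟨?_, h.2⟩
          rw [hA]
          exact Finset.mem_union_left _ (Finset.mem_union_left _ (Finset.mem_erase.2 ⟨hxy, h.1⟩))
      refine ih1 ⟨φ, fun w hw => ?_⟩
      rcases transGen_split (R := fun x y => (x, y) ∈ D.arcs ∧ φ x = φ y) (u := u1) (v := v1)
        hsp hw with h | ⟨h1, h2⟩
      · exact hφ w h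
      · exact hcon (h2.trans h1)
    have p2 : Relation.ReflTransGen (fun x y => (x, y) ∈ D.arcs ∧ φ x = φ y) u2 v1 := by
      by_contra hcon
      have hl : ∀ x y, ((x, y) ∈ D2.arcs.erase (v2, u2) ∧ φ (g x) = φ (g y)) →
          ((g x, g y) ∈ D.arcs ∧ φ (g x) = φ (g y)) := by
        rintro x y ⟨h, h'⟩
        refine ⟨?_, h'⟩
        rw [hA]
        exact Finset.mem_union_left _ (Finset.mem_union_right _
          (Finset.mem_image.2 ⟨(x, y), h, rfl⟩))
      have hsp : ∀ x y, ((x, y) ∈ D2.arcs ∧ φ (g x) = φ (g y)) →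
          ((x, y) ∈ D2.arcs.erase (v2, u2) ∧ φ (g x) = φ (g y)) ∨ (x = v2 ∧ y = u2) := by
        intro x y h
        by_cases hxy : (x, y) = (v2, u2)
        · exact Or.inr (by simpa using hxy)
        · exact Or.inl ⟨Finset.mem_erase.2 ⟨hxy, h.1⟩, h.2⟩
      refine ih2 ⟨fun x => φ (g x), fun w hw => ?_⟩
      rcases transGen_split
        (R := fun x y => (x, y) ∈ D2.arcs.erase (v2, u2) ∧ φ (g x) = φ (g y)) (u := v2) (v := u2)
        hsp hw with h | ⟨h1, h2⟩
      · exact hφ (g w) (tlift g hl h)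
      · apply hcon
        have := rlift
          (R := fun x y => (x, y) ∈ D.arcs ∧ φ x = φ y) g hl (h2.trans h1)
        rwa [hu2, hv2] at this
    have harc : (u1, u2) ∈ D.arcs := by rw [hA]; simp
    exact hφ u1 (Relation.TransGen.head' ⟨harc, (mono_color p1).symm.trans (mono_color p2).symm⟩
      (p2.trans p1))
  | ident D' D I v _ hi ih =>
    obtain ⟨hne, hsub, hind, hv, hV, hA⟩ := hi
    refine fun hc => ih (hc.of_hom (fun x => if x ∈ I then v else x) ?_)
    intro x y hxy
    rw [hA]
    by_cases hx : x ∈ I <;> by_cases hy : y ∈ I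
    · exact absurd hxy (hind x hx y hy)
    · simp only [hx, hy, if_true, if_false]
      exact Finset.mem_union_left _ (Finset.mem_union_right _
        (Finset.mem_image.2 ⟨(x, y), Finset.mem_filter.2 ⟨hxy, hx, hy⟩, rfl⟩))
    · simp only [hx, hy, if_true, if_false]
      exact Finset.mem_union_right _
        (Finset.mem_image.2 ⟨(x, y), Finset.mem_filter.2 ⟨hxy, hx, hy⟩, rfl⟩)
    · simp only [hx, hy, if_false]
      exact Finset.mem_union_left _ (Finset.mem_union_left _
        (Finset.mem_filter.2 ⟨hxy, hx, hy⟩))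
  | iso D D' _ hi ih =>
    obtain ⟨f, _, hf⟩ := hi
    refine fun hc => ih (hc.of_hom f ?_)
    intro x y hxy
    have := D.arcs_sub _ hxy
    exact (hf x this.1 y this.2).1 hxy

/-- The image of a digraph under a map that creates no loops. -/
def mapD (f : ℕ → ℕ) (H : Digr) (h : ∀ a ∈ H.arcs, f a.1 ≠ f a.2) : Digr where
  verts := H.verts.image f
  arcs := H.arcs.image (Prod.map f f)
  arcs_sub := by
    intro a ha
    obtain ⟨b, hb, rfl⟩ := Finset.mem_image.1 ha
    have := H.arcs_sub b hb
    exact ⟨Finset.mem_image_of_mem _ this.1, Finset.mem_image_of_mem _ this.2⟩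
  no_loops := by
    intro a ha
    obtain ⟨b, hb, rfl⟩ := Finset.mem_image.1 ha
    exact h b hb

theorem HajosConstr.map_aux {k : ℕ} (f : ℕ → ℕ) (K : Digr) : ∀ (n : ℕ) (H : Digr),
    H.verts.card = n → HajosConstr k H → K.verts = H.verts.image f →
    K.arcs = H.arcs.image (Prod.map f f) → HajosConstr k K := by
  intro n
  induction n using Nat.strong_induction_on with
  | _ n ih =>
  intro H hn hH hKv hKa
  have hloop : ∀ a b, (a, b) ∈ H.arcs → f a ≠ f b := by
    intro a b hab
    exact K.no_loops (f a, f b) (by rw [hKa]; exact Finset.mem_image.2 ⟨(a, b), hab, rfl⟩)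
  by_cases hinj : Set.InjOn f ↑H.verts
  · refine .iso H K hH ⟨f, ⟨?_, hinj, ?_⟩, ?_⟩
    · intro x hx
      rw [hKv]
      exact Finset.mem_coe.2 (Finset.mem_image_of_mem f hx)
    · intro y hy
      rw [hKv] at hy
      simpa using hy
    · intro x hx y hy
      rw [hKa]
      constructor
      · intro h
        exact Finset.mem_image.2 ⟨(x, y), h, rfl⟩
      · intro h
        obtain ⟨⟨a, b⟩, hab, he⟩ := Finset.mem_image.1 h
        have hab' := H.arcs_sub _ hab
        simp only [Prod.map_apply, Prod.mk.injEq] at he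
        rw [← hinj hab'.1 hx he.1, ← hinj hab'.2 hy he.2]
        exact hab
  · simp only [Set.InjOn] at hinj
    push Not at hinj
    obtain ⟨x, hx, y, hy, hfxy, hxy⟩ := hinj
    have hx : x ∈ H.verts := hx
    have hy : y ∈ H.verts := hy
    set g : ℕ → ℕ := fun z => if z = y then x else z with hg
    have hfg : ∀ z, f (g z) = f z := by
      intro z
      by_cases hz : z = y
      · simp [hg, hz, hfxy]
      · simp [hg, hz]
    have hfg' : f ∘ g = f := funext hfg
    have hgl : ∀ a ∈ H.arcs, g a.1 ≠ g a.2 := by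
      rintro ⟨a, b⟩ hab he
      exact hloop a b hab (by rw [← hfg a, ← hfg b]; exact congrArg f he)
    have hgI : ∀ z, z ∈ ({x, y} : Finset ℕ) → g z = x := by
      intro z hz
      rcases Finset.mem_insert.1 hz with rfl | hz
      · simp [hg]
      · simp [hg, Finset.mem_singleton.1 hz]
    have hgN : ∀ z, z ∉ ({x, y} : Finset ℕ) → g z = z := by
      intro z hz
      simp only [Finset.mem_insert, Finset.mem_singleton, not_or] at hz
      simp [hg, hz.2]
    have hind : ∀ a ∈ ({x, y} : Finset ℕ), ∀ b ∈ ({x, y} : Finset ℕ), (a, b) ∉ H.arcs := by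
      intro a ha b hb hab
      exact hgl _ hab ((hgI a ha).trans (hgI b hb).symm)
    have hid : IsIdent (mapD g H hgl) H {x, y} x := by
      refine ⟨⟨x, by simp⟩, ?_, hind, Or.inl (by simp), ?_, ?_⟩
      · intro z hz
        rcases Finset.mem_insert.1 hz with rfl | hz
        · exact hx
        · rw [Finset.mem_singleton.1 hz]; exact hy
      · ext z
        simp only [mapD, Finset.mem_image, Finset.mem_union, Finset.mem_sdiff,
          Finset.mem_singleton]
        constructor
        · rintro ⟨w, hw, rfl⟩
          by_cases hwI : w ∈ ({x, y} : Finset ℕ)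
          · exact Or.inr (hgI w hwI)
          · rw [hgN w hwI]; exact Or.inl ⟨hw, hwI⟩
        · rintro (⟨hz, hzI⟩ | rfl)
          · exact ⟨z, hz, hgN z hzI⟩
          · exact ⟨z, hx, hgI z (by simp)⟩
      · ext ⟨p, q⟩
        simp only [mapD, Finset.mem_image, Finset.mem_union, Finset.mem_filter]
        constructor
        · rintro ⟨⟨a, b⟩, hab, he⟩
          simp only [Prod.map_apply, Prod.mk.injEq] at he
          obtain ⟨rfl, rfl⟩ := he
          by_cases ha : a ∈ ({x, y} : Finset ℕ) <;> by_cases hb : b ∈ ({x, y} : Finset ℕ)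
          · exact absurd hab (hind a ha b hb)
          · rw [hgI a ha, hgN b hb]
            exact Or.inl (Or.inr ⟨(a, b), ⟨hab, ha, hb⟩, rfl⟩)
          · rw [hgN a ha, hgI b hb]
            exact Or.inr ⟨(a, b), ⟨hab, ha, hb⟩, rfl⟩
          · rw [hgN a ha, hgN b hb]
            exact Or.inl (Or.inl ⟨hab, ha, hb⟩)
        · rintro ((⟨hab, ha, hb⟩ | ⟨⟨a, b⟩, ⟨hab, ha, hb⟩, he⟩) | ⟨⟨a, b⟩, ⟨hab, ha, hb⟩, he⟩)
          · exact ⟨(p, q), hab, by rw [Prod.map_apply, hgN p ha, hgN q hb]⟩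
          · exact ⟨(a, b), hab, by rw [Prod.map_apply, hgI a ha, hgN b hb]; exact he⟩
          · exact ⟨(a, b), hab, by rw [Prod.map_apply, hgN a ha, hgI b hb]; exact he⟩
    refine ih (mapD g H hgl).verts.card ?_ (mapD g H hgl) rfl (.ident _ _ _ _ hH hid) ?_ ?_
    · rw [← hn]
      apply Finset.card_lt_card
      refine ⟨?_, fun hs => ?_⟩
      · intro z hz
        obtain ⟨w, hw, rfl⟩ := Finset.mem_image.1 hz
        by_cases hwy : w = y
        · simpa [hg, hwy] using hx
        · simpa [hg, hwy] using hw
      · obtain ⟨w, hw, he⟩ := Finset.mem_image.1 (hs hy)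
        by_cases hwy : w = y
        · simp [hg, hwy, hxy] at he
        · simp [hg, hwy] at he
    · rw [hKv]
      simp only [mapD]
      rw [Finset.image_image, hfg']
    · rw [hKa]
      simp only [mapD]
      rw [Finset.image_image, Prod.map_comp_map, hfg']

theorem HajosConstr.mapD {k : ℕ} {H : Digr} (hH : HajosConstr k H) (f : ℕ → ℕ)
    (h : ∀ a ∈ H.arcs, f a.1 ≠ f a.2) : HajosConstr k (mapD f H h) :=
  HajosConstr.map_aux f _ _ H rfl hH rfl rfl

theorem join_in {k : ℕ} {H1 H2 D : Digr} {u1 v u2 : ℕ}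
    (h1 : HajosConstr k H1) (h2 : HajosConstr k H2)
    (a1 : (u1, v) ∈ H1.arcs) (a2 : (v, u2) ∈ H2.arcs)
    (hv1 : H1.verts ⊆ D.verts) (hv2 : H2.verts ⊆ D.verts)
    (hs1 : H1.arcs.erase (u1, v) ⊆ D.arcs) (hs2 : H2.arcs.erase (v, u2) ⊆ D.arcs)
    (ha : (u1, u2) ∈ D.arcs) : ∃ K : Digr, K.Sub D ∧ HajosConstr k K := by
  obtain ⟨N, hN⟩ : ∃ N, ∀ x ∈ D.verts, x < N :=
    ⟨D.verts.sup id + 1, fun x hx => Nat.lt_succ_of_le (Finset.le_sup (f := id) hx)⟩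
  set f : ℕ → ℕ := fun x => if x < N then x else x - N with hf
  have hf1 : ∀ x ∈ D.verts, f x = x := fun x hx => by simp [hf, hN x hx]
  have hf2 : ∀ x, f (x + N) = x := fun x => by simp [hf]
  have hinj : ∀ a ∈ H2.arcs, (fun x => x + N) a.1 ≠ (fun x => x + N) a.2 := by
    intro a ha
    have := H2.no_loops a ha
    simpa using this
  have h2' := h2.mapD (fun x => x + N) hinj
  set H2' := Digr.mapD (fun x => x + N) H2 hinj with hH2'
  set g : ℕ → ℕ := fun x => if x = v + N then v else x with hg
  have huv : u2 ≠ v := fun h => H2.no_loops _ a2 h.symm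
  have hvD : v ∈ D.verts := hv1 (H1.arcs_sub _ a1).2
  have hfg : ∀ x, f (g (x + N)) = x := by
    intro x
    by_cases hx : x = v
    · simp only [hg, hx, if_true]; exact hf1 v hvD
    · simp only [hg, Nat.add_right_cancel_iff, hx, if_false]; exact hf2 x
  have key : ∀ a ∈ H1.arcs.erase (u1, v) ∪
      (H2'.arcs.erase (v + N, u2 + N)).image (Prod.map g g) ∪ {(u1, u2 + N)},
      (f a.1, f a.2) ∈ D.arcs := by
    intro a ha'
    rcases Finset.mem_union.1 ha' with h | h
    · rcases Finset.mem_union.1 h with h | h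
      · have hD := hs1 h
        have hm := D.arcs_sub _ hD
        rw [hf1 _ hm.1, hf1 _ hm.2]
        exact hD
      · obtain ⟨b, hb, rfl⟩ := Finset.mem_image.1 h
        obtain ⟨hbne, hb⟩ := Finset.mem_erase.1 hb
        obtain ⟨⟨p, q⟩, hpq, rfl⟩ := Finset.mem_image.1 hb
        simp only [Prod.map_apply, hfg]
        apply hs2
        refine Finset.mem_erase.2 ⟨?_, hpq⟩
        rintro h
        rw [Prod.mk.injEq] at h
        exact hbne (by simp [h.1, h.2])
    · rw [Finset.mem_singleton.1 h]
      simp only [hf2, hf1 u1 (D.arcs_sub _ ha).1]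
      exact ha
  let J : Digr :=
    { verts := H1.verts ∪ H2'.verts.erase (v + N)
      arcs := H1.arcs.erase (u1, v) ∪
        (H2'.arcs.erase (v + N, u2 + N)).image (Prod.map g g) ∪ {(u1, u2 + N)}
      arcs_sub := by
        have hgm : ∀ x ∈ H2'.verts, g x ∈ H1.verts ∪ H2'.verts.erase (v + N) := by
          intro x hx
          by_cases h : x = v + N
          · simp only [hg, h, if_true]
            exact Finset.mem_union_left _ (H1.arcs_sub _ a1).2
          · simp only [hg, h, if_false]
            exact Finset.mem_union_right _ (Finset.mem_erase.2 ⟨h, hx⟩)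
        intro a ha'
        rcases Finset.mem_union.1 ha' with h | h
        · rcases Finset.mem_union.1 h with h | h
          · have := H1.arcs_sub _ (Finset.mem_of_mem_erase h)
            exact ⟨Finset.mem_union_left _ this.1, Finset.mem_union_left _ this.2⟩
          · obtain ⟨b, hb, rfl⟩ := Finset.mem_image.1 h
            have := H2'.arcs_sub _ (Finset.mem_of_mem_erase hb)
            exact ⟨hgm _ this.1, hgm _ this.2⟩
        · rw [Finset.mem_singleton.1 h]
          refine ⟨Finset.mem_union_left _ (H1.arcs_sub _ a1).1,
            Finset.mem_union_right _ (Finset.mem_erase.2 ⟨?_, ?_⟩)⟩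
          · simpa using huv
          · exact Finset.mem_image.2 ⟨u2, (H2.arcs_sub _ a2).2, rfl⟩
      no_loops := by
        intro a ha' he
        exact D.no_loops _ (key a ha') (congrArg f he) }
  have hJ : HajosConstr k J := by
    refine .join J H1 H2' u1 v (v + N) (u2 + N) h1 h2' ⟨?_, a1, ?_, rfl, rfl⟩
    · rw [Finset.disjoint_left]
      intro x hx hx'
      obtain ⟨w, _, rfl⟩ := Finset.mem_image.1 hx'
      have := hN _ (hv1 hx)
      simp at this
    · exact Finset.mem_image.2 ⟨(v, u2), a2, rfl⟩
  refine ⟨Digr.mapD f J (fun a ha' => D.no_loops _ (key a ha')), ⟨?_, ?_⟩, hJ.mapD _ _⟩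
  · intro z hz
    obtain ⟨w, hw, rfl⟩ := Finset.mem_image.1 hz
    rcases Finset.mem_union.1 hw with h | h
    · rw [hf1 w (hv1 h)]; exact hv1 h
    · obtain ⟨p, hp, rfl⟩ := Finset.mem_image.1 (Finset.mem_of_mem_erase h)
      simp only [hf2]
      exact hv2 hp
  · intro z hz
    obtain ⟨w, hw, rfl⟩ := Finset.mem_image.1 hz
    exact key w hw

/-- Adding an arc. -/
def addArc (D : Digr) (x y : ℕ) (hx : x ∈ D.verts) (hy : y ∈ D.verts) (hxy : x ≠ y) : Digr where
  verts := D.verts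
  arcs := insert (x, y) D.arcs
  arcs_sub := by
    intro a ha
    rcases Finset.mem_insert.1 ha with rfl | ha
    · exact ⟨hx, hy⟩
    · exact D.arcs_sub a ha
  no_loops := by
    intro a ha
    rcases Finset.mem_insert.1 ha with rfl | ha
    · exact hxy
    · exact D.no_loops a ha

/-- The complete bidirected digraph on a finite set. -/
def complete (S : Finset ℕ) : Digr where
  verts := S
  arcs := (S ×ˢ S).filter (fun a => a.1 ≠ a.2)
  arcs_sub := by
    intro a ha
    exact Finset.mem_product.1 (Finset.mem_filter.1 ha).1
  no_loops := by
    intro a ha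
    exact (Finset.mem_filter.1 ha).2

theorem colorable_of_maximal {k : ℕ} (hk : 3 ≤ k) (D : Digr)
    (hD : ¬ ∃ H : Digr, H.Sub D ∧ HajosConstr k H)
    (hmax : ∀ x y, ∀ (hx : x ∈ D.verts) (hy : y ∈ D.verts) (hxy : x ≠ y), (x, y) ∉ D.arcs →
      ∃ H : Digr, H.Sub (D.addArc x y hx hy hxy) ∧ HajosConstr k H) :
    D.Colorable (k - 1) := by
  have hmax' : ∀ x y, x ∈ D.verts → y ∈ D.verts → x ≠ y → (x, y) ∉ D.arcs →
      ∃ H : Digr, HajosConstr k H ∧ (x, y) ∈ H.arcs ∧ H.verts ⊆ D.verts ∧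
        H.arcs.erase (x, y) ⊆ D.arcs := by
    intro x y hx hy hxy hn
    obtain ⟨H, ⟨hs1, hs2⟩, hH⟩ := hmax x y hx hy hxy hn
    have hs : H.arcs.erase (x, y) ⊆ D.arcs := by
      intro a ha
      obtain ⟨hne, ha⟩ := Finset.mem_erase.1 ha
      exact (Finset.mem_insert.1 (hs2 ha)).resolve_left hne
    refine ⟨H, hH, ?_, hs1, hs⟩
    by_contra hnot
    rw [Finset.erase_eq_of_notMem hnot] at hs
    exact hD ⟨H, ⟨hs1, hs⟩, hH⟩
  let r : ℕ → ℕ → Prop := fun x y => x = y ∨ (x ∈ D.verts ∧ y ∈ D.verts ∧ (x, y) ∉ D.arcs)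
  have hrefl : ∀ x, r x x := fun x => Or.inl rfl
  have htrans : ∀ x y z, r x y → r y z → r x z := by
    intro x y z hxy hyz
    rcases hxy with rfl | ⟨hx, hy, hxy⟩
    · exact hyz
    rcases hyz with rfl | ⟨_, hz, hyz⟩
    · exact Or.inr ⟨hx, hy, hxy⟩
    by_cases e1 : x = y
    · subst e1; exact Or.inr ⟨hx, hz, hyz⟩
    by_cases e2 : y = z
    · subst e2; exact Or.inr ⟨hx, hz, hxy⟩
    refine Or.inr ⟨hx, hz, fun hxz => hD ?_⟩
    obtain ⟨H1, c1, m1, s1, t1⟩ := hmax' x y hx hy e1 hxy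
    obtain ⟨H2, c2, m2, s2, t2⟩ := hmax' y z hy hz e2 hyz
    exact join_in c1 c2 m1 m2 s1 s2 t1 t2 hxz
  obtain ⟨φ, hφ, hφc⟩ := @dilworth_aux ℕ _
    { le := r, lt := fun x y => r x y ∧ ¬ r y x, le_refl := hrefl, le_trans := htrans } D.verts (k - 1) (by
      intro A hA hanti
      by_contra hcard
      obtain ⟨S, hSA, hSk⟩ := Finset.exists_subset_card_eq (show k ≤ A.card by omega)
      refine hD ⟨complete S, ⟨hSA.trans hA, ?_⟩, .base _ hSk rfl⟩
      rintro ⟨x, y⟩ ha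
      obtain ⟨hm, hne⟩ := Finset.mem_filter.1 ha
      obtain ⟨hx, hy⟩ := Finset.mem_product.1 hm
      by_contra hnot
      exact hanti x (hSA hx) y (hSA hy) hne (Or.inr ⟨hA (hSA hx), hA (hSA hy), hnot⟩))
  refine ⟨fun x => if h : φ x < k - 1 then ⟨φ x, h⟩ else ⟨0, by omega⟩, fun v hv => ?_⟩
  have hlt : ∀ a b, Relation.TransGen (fun x y => (x, y) ∈ D.arcs ∧
      (if h : φ x < k - 1 then (⟨φ x, h⟩ : Fin (k - 1)) else ⟨0, by omega⟩) =
      (if h : φ y < k - 1 then (⟨φ y, h⟩ : Fin (k - 1)) else ⟨0, by omega⟩)) a b →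
      r b a ∧ ¬ r a b := by
    have hstep : ∀ x y, ((x, y) ∈ D.arcs ∧
      (if h : φ x < k - 1 then (⟨φ x, h⟩ : Fin (k - 1)) else ⟨0, by omega⟩) =
      (if h : φ y < k - 1 then (⟨φ y, h⟩ : Fin (k - 1)) else ⟨0, by omega⟩)) →
      r y x ∧ ¬ r x y := by
      rintro x y ⟨hxy, he⟩
      obtain ⟨hx, hy⟩ := D.arcs_sub _ hxy
      have hne := D.no_loops _ hxy
      rw [dif_pos (hφ x hx), dif_pos (hφ y hy), Fin.mk.injEq] at he
      have hn : ¬ r x y := by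
        rintro (h | h)
        · exact hne h
        · exact h.2.2 hxy
      exact ⟨(hφc x hx y hy he).resolve_left hn, hn⟩
    intro a b hab
    induction hab with
    | single h => exact hstep _ _ h
    | tail _ h ih =>
      have := hstep _ _ h
      exact ⟨htrans _ _ _ this.1 ih.1, fun hac => this.2 (htrans _ _ _ ih.1 hac)⟩
  exact (hlt v v hv).2 (hrefl v)

theorem colorable_of_no_sub {k : ℕ} (hk : 3 ≤ k) : ∀ (n : ℕ) (D : Digr),
    (D.verts ×ˢ D.verts \ D.arcs).card = n →
    (¬ ∃ H : Digr, H.Sub D ∧ HajosConstr k H) → D.Colorable (k - 1) := by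
  intro n
  induction n using Nat.strong_induction_on with
  | _ n ih =>
  intro D hn hD
  by_cases hmax : ∀ x y, ∀ (hx : x ∈ D.verts) (hy : y ∈ D.verts) (hxy : x ≠ y),
      (x, y) ∉ D.arcs → ∃ H : Digr, H.Sub (D.addArc x y hx hy hxy) ∧ HajosConstr k H
  · exact colorable_of_maximal hk D hD hmax
  · push Not at hmax
    obtain ⟨x, y, hx, hy, hxy, hna, hno⟩ := hmax
    refine Colorable.of_sub (D := D.addArc x y hx hy hxy) (Finset.subset_insert _ _)
      (ih _ ?_ _ rfl ?_)
    · rw [← hn]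
      apply Finset.card_lt_card
      refine ⟨?_, fun hs => ?_⟩
      · exact Finset.sdiff_subset_sdiff (Finset.Subset.refl _) (Finset.subset_insert _ _)
      · have : (x, y) ∈ D.verts ×ˢ D.verts \ D.arcs :=
          Finset.mem_sdiff.2 ⟨Finset.mem_product.2 ⟨hx, hy⟩, hna⟩
        exact (Finset.mem_sdiff.1 (hs this)).2 (Finset.mem_insert_self _ _)
    · rintro ⟨H, h1, h2⟩
      exact hno H h1 h2

end Digr

open Digr in
/-- For `k ≥ 3`, a digraph `D` has dichromatic number at least `k`
iff it contains a Hajós-`k`-constructible subdigraph. -/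
theorem dichromatic_ge_iff_hajosConstructible_subdigraph (k : ℕ) (hk : 3 ≤ k)
    (D : Digr) :
    k ≤ D.dichrom ↔ ∃ H : Digr, H.Sub D ∧ HajosConstr k H := by
  constructor
  · intro h
    by_contra hno
    have := Digr.colorable_of_no_sub hk _ D rfl hno
    have := Nat.sInf_le (s := {n | D.Colorable n}) this
    unfold dichrom at h
    omega
  · rintro ⟨H, hs, hH⟩
    refine le_csInf D.exists_colorable ?_
    intro n hn
    by_contra hlt
    have hn : D.Colorable n := hn
    exact hH.not_colorable hk (Digr.Colorable.of_sub hs.2 (hn.mono (by omega)))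
end
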